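/- arXiv:1709.03938 — 2 statements merged into one kernel-verified Lean document; each statement's English description precedes it below -/
import Mathlib

section
/- One-dimensional duality relation between the control system and the dual system: ∫₀ᴸ u(x,T) y(x) / c(x)² dx = ∫₀ᵀ f(t) (−∂ₓv(0,t)) dt, where −∂ₓ is the outward normal derivative at the controlled endpoint x = 0. That is, the interior pairing of the wave u(·,T) with the perturbation y equals the exterior pairing of the control f with the normal derivative of the dual wave on the controlled part of the boundary. -/
open MeasureTheory

/-- The partial derivative in the first variable of a `C^(n+1)` function is `C^n`. -/
theorem contDiff_deriv_fst {n m : WithTop ℕ∞} {w : ℝ → ℝ → ℝ}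
    (hw : ContDiff ℝ n (fun p : ℝ × ℝ => w p.1 p.2)) (hmn : m + 1 ≤ n) :
    ContDiff ℝ m (fun p : ℝ × ℝ => deriv (fun z => w z p.2) p.1) := by
  have hd : Differentiable ℝ (fun p : ℝ × ℝ => w p.1 p.2) :=
    (hw.of_le ((le_add_self).trans hmn)).differentiable one_ne_zero
  have key : (fun p : ℝ × ℝ => deriv (fun z => w z p.2) p.1) =
      fun p : ℝ × ℝ => fderiv ℝ (fun p : ℝ × ℝ => w p.1 p.2) p (1, 0) := by
    funext p
    exact HasDerivAt.deriv (((hd p).hasFDerivAt).comp_hasDerivAt_of_eq p.1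
      ((hasDerivAt_id p.1).prodMk (hasDerivAt_const p.1 p.2)) rfl)
  rw [key]
  exact (hw.fderiv_right hmn).clm_apply contDiff_const

/-- The partial derivative in the second variable of a `C^(n+1)` function is `C^n`. -/
theorem contDiff_deriv_snd {n m : WithTop ℕ∞} {w : ℝ → ℝ → ℝ}
    (hw : ContDiff ℝ n (fun p : ℝ × ℝ => w p.1 p.2)) (hmn : m + 1 ≤ n) :
    ContDiff ℝ m (fun p : ℝ × ℝ => deriv (w p.1) p.2) :=
  (contDiff_deriv_fst (w := fun t x => w x t) (hw.comp (contDiff_snd.prodMk contDiff_fst))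
    hmn).comp (contDiff_snd.prodMk contDiff_fst)

/-- Lagrange's identity for twice continuously differentiable functions on an interval. -/
theorem integral_mul_deriv_deriv_sub {a b : ℝ} {f g : ℝ → ℝ}
    (hf : ContDiff ℝ 2 f) (hg : ContDiff ℝ 2 g) :
    ∫ x in a..b, (f x * deriv (deriv g) x - deriv (deriv f) x * g x) =
      (f b * deriv g b - deriv f b * g b) - (f a * deriv g a - deriv f a * g a) := by
  have hf' : ContDiff ℝ 1 (deriv f) := ContDiff.deriv' (n := 1) (by simpa [one_add_one_eq_two] using hf)
  have hg' : ContDiff ℝ 1 (deriv g) := ContDiff.deriv' (n := 1) (by simpa [one_add_one_eq_two] using hg)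
  have hf0 := hf.continuous
  have hg0 := hg.continuous
  have hf2 : Continuous (deriv (deriv f)) := hf'.continuous_deriv le_rfl
  have hg2 : Continuous (deriv (deriv g)) := hg'.continuous_deriv le_rfl
  refine intervalIntegral.integral_eq_sub_of_hasDerivAt
    (f := fun x => f x * deriv g x - deriv f x * g x) (fun x _ => ?_)
    (Continuous.intervalIntegrable (by fun_prop) a b)
  have hfx := (hf.differentiable two_ne_zero x).hasDerivAt
  have hgx := (hg.differentiable two_ne_zero x).hasDerivAt
  have hfx' := (hf'.differentiable one_ne_zero x).hasDerivAt
  have hgx' := (hg'.differentiable one_ne_zero x).hasDerivAt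
  refine ((hfx.mul hgx').sub (hfx'.mul hgx)).congr_deriv ?_
  ring

/-- one-dimensional duality relation between the control system and the dual
system: `∫₀ᴸ u(x,T) y(x) / c(x)² dx = ∫₀ᵀ f(t) (−∂ₓv(0,t)) dt`, where `y(x) = ∂ₜv(x,T)`
and `f(t) = u(0,t)` is the boundary control acting at the endpoint `x = 0`. -/
theorem one_dim_duality (L T : ℝ) (hL : 0 < L) (hT : 0 < T)
    (c q : ℝ → ℝ) (hc : Continuous c) (hq : Continuous q)
    (hcpos : ∀ x ∈ Set.Icc 0 L, 0 < c x)
    (u v : ℝ → ℝ → ℝ)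
    (hu : ContDiff ℝ 2 (fun p : ℝ × ℝ => u p.1 p.2))
    (hv : ContDiff ℝ 2 (fun p : ℝ × ℝ => v p.1 p.2))
    (huwave : ∀ x ∈ Set.Icc (0:ℝ) L, ∀ t ∈ Set.Icc (0:ℝ) T,
      deriv (deriv (u x)) t =
        (c x) ^ 2 * (deriv (deriv (fun z => u z t)) x - q x * u x t))
    (hvwave : ∀ x ∈ Set.Icc (0:ℝ) L, ∀ t ∈ Set.Icc (0:ℝ) T,
      deriv (deriv (v x)) t =
        (c x) ^ 2 * (deriv (deriv (fun z => v z t)) x - q x * v x t))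
    (hu0 : ∀ x ∈ Set.Icc (0:ℝ) L, u x 0 = 0)
    (hu0' : ∀ x ∈ Set.Icc (0:ℝ) L, deriv (u x) 0 = 0)
    (hvT : ∀ x ∈ Set.Icc (0:ℝ) L, v x T = 0)
    (huL : ∀ t ∈ Set.Icc (0:ℝ) T, u L t = 0)
    (hv0 : ∀ t ∈ Set.Icc (0:ℝ) T, v 0 t = 0)
    (hvL : ∀ t ∈ Set.Icc (0:ℝ) T, v L t = 0) :
    ∫ x in (0:ℝ)..L, u x T * deriv (v x) T / (c x) ^ 2 =
      ∫ t in (0:ℝ)..T, u 0 t * (-(deriv (fun z => v z t) 0)) := by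
  have hu₁ (t : ℝ) : ContDiff ℝ 2 (fun z => u z t) :=
    hu.comp (contDiff_id.prodMk contDiff_const)
  have hv₁ (t : ℝ) : ContDiff ℝ 2 (fun z => v z t) :=
    hv.comp (contDiff_id.prodMk contDiff_const)
  have hu₂ (x : ℝ) : ContDiff ℝ 2 (u x) :=
    hu.comp (contDiff_const.prodMk contDiff_id)
  have hv₂ (x : ℝ) : ContDiff ℝ 2 (v x) :=
    hv.comp (contDiff_const.prodMk contDiff_id)
  have huxx : Continuous (fun p : ℝ × ℝ => deriv (deriv (fun z => u z p.2)) p.1) :=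
    (contDiff_deriv_fst (m := 0) (w := fun x t => deriv (fun z => u z t) x)
      (contDiff_deriv_fst (m := 1) hu (by norm_num)) (by norm_num)).continuous
  have hvxx : Continuous (fun p : ℝ × ℝ => deriv (deriv (fun z => v z p.2)) p.1) :=
    (contDiff_deriv_fst (m := 0) (w := fun x t => deriv (fun z => v z t) x)
      (contDiff_deriv_fst (m := 1) hv (by norm_num)) (by norm_num)).continuous
  have hu_cont := hu.continuous
  have hv_cont := hv.continuous
  have time_eq : ∀ x ∈ Set.uIcc (0:ℝ) L, u x T * deriv (v x) T / (c x) ^ 2 =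
      ∫ t in (0:ℝ)..T, (u x t * deriv (deriv (fun z => v z t)) x -
        deriv (deriv (fun z => u z t)) x * v x t) := by
    intro x hx
    rw [Set.uIcc_of_le hL.le] at hx
    have hlag := integral_mul_deriv_deriv_sub (a := 0) (b := T) (hu₂ x) (hv₂ x)
    rw [hu0 x hx, hu0' x hx, hvT x hx] at hlag
    rw [div_eq_iff (pow_ne_zero 2 (hcpos x hx).ne'), ← intervalIntegral.integral_mul_const]
    refine Eq.trans (hlag.trans (by ring)).symm ?_
    refine intervalIntegral.integral_congr fun t ht => ?_
    rw [Set.uIcc_of_le hT.le] at ht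
    simp only [huwave x hx t ht, hvwave x hx t ht]
    ring
  have space_eq : ∀ t ∈ Set.uIcc (0:ℝ) T,
      ∫ x in (0:ℝ)..L, (u x t * deriv (deriv (fun z => v z t)) x -
        deriv (deriv (fun z => u z t)) x * v x t) =
      u 0 t * (-(deriv (fun z => v z t) 0)) := by
    intro t ht
    rw [Set.uIcc_of_le hT.le] at ht
    rw [integral_mul_deriv_deriv_sub (hu₁ t) (hv₁ t), huL t ht, hv0 t ht, hvL t ht]
    ring
  rw [intervalIntegral.integral_congr time_eq, ← intervalIntegral.integral_congr space_eq]
  exact intervalIntegral_intervalIntegral_swap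
    (((hu_cont.mul hvxx).sub (huxx.mul hv_cont)).continuousOn.integrableOn_compact
      (isCompact_uIcc.prod isCompact_uIcc) |>.mono_set
        (Set.prod_mono Set.uIoc_subset_uIcc Set.uIoc_subset_uIcc))
end

section
/- One-dimensional product of a harmonic (affine) function with a wave via boundary data: for a(x) = α + βx, ∫₀ᴸ a(x) u(x,T) / c(x)² dx = ∫₀ᵀ (T − t) [ a(L) ∂ₓu(L,t) − a(0) ∂ₓu(0,t) − β (u(L,t) − u(0,t)) ] dt. In other words, the interior pairing of any affine (one-dimensional harmonic) function with the invisible wave u(·,T) is expressed entirely through the boundary values and boundary normal derivatives of u over the time interval [0,T]. -/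
open MeasureTheory

/-- A partial derivative of a `C^m` function of two variables is `C^n` for `n + 1 ≤ m`. -/
theorem ContDiff.deriv_fst {m n : WithTop ℕ∞} {f : ℝ × ℝ → ℝ} (hf : ContDiff ℝ m f)
    (hmn : n + 1 ≤ m) : ContDiff ℝ n (fun p : ℝ × ℝ => deriv (fun z => f (z, p.2)) p.1) := by
  have hm : m ≠ 0 := by
    rintro rfl
    simp at hmn
  have h : (fun p : ℝ × ℝ => deriv (fun z => f (z, p.2)) p.1) =
      fun p => fderiv ℝ f p (1, 0) := by
    funext p
    have hF : HasFDerivAt f (fderiv ℝ f p) (p.1, p.2) := (hf.differentiable hm p).hasFDerivAt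
    exact (hF.comp_hasDerivAt p.1 ((hasDerivAt_id p.1).prodMk (hasDerivAt_const p.1 p.2))).deriv
  rw [h]
  exact (hf.fderiv_right hmn).clm_apply contDiff_const

/-- Integration by parts of an affine function against a second derivative. -/
theorem integral_affine_mul_deriv_deriv {f : ℝ → ℝ} (hf : ContDiff ℝ 2 f) (a b α β : ℝ) :
    ∫ x in a..b, (α + β * x) * deriv (deriv f) x =
      ((α + β * b) * deriv f b - β * f b) - ((α + β * a) * deriv f a - β * f a) := by
  have hf' : ContDiff ℝ 1 (deriv f) := ContDiff.deriv' (n := 1) hf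
  have hc : Continuous (deriv (deriv f)) := hf'.continuous_deriv le_rfl
  refine intervalIntegral.integral_eq_sub_of_hasDerivAt
    (f := fun x => (α + β * x) * deriv f x - β * f x) (fun x _ => ?_)
    (Continuous.intervalIntegrable (by fun_prop) _ _)
  have h₁ : HasDerivAt f (deriv f x) x := (hf.differentiable (by norm_num) x).hasDerivAt
  have h₂ : HasDerivAt (deriv f) (deriv (deriv f) x) x :=
    (hf'.differentiable (by norm_num) x).hasDerivAt
  have h₃ : HasDerivAt (fun x : ℝ => α + β * x) β x := by
    simpa using ((hasDerivAt_id x).const_mul β).const_add α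
  exact ((h₃.mul h₂).sub (h₁.const_mul β)).congr_deriv (by ring)

/-- one-dimensional product of an affine (harmonic) function `a(x) = α + βx`
with a wave via boundary data:
`∫₀ᴸ a(x) u(x,T) / c(x)² dx
  = ∫₀ᵀ (T − t) [a(L) ∂ₓu(L,t) − a(0) ∂ₓu(0,t) − β (u(L,t) − u(0,t))] dt`. -/
theorem one_dim_harmonic_wave_product (L T : ℝ) (hL : 0 < L) (hT : 0 < T)
    (c : ℝ → ℝ) (hc : Continuous c) (hcpos : ∀ x ∈ Set.Icc 0 L, 0 < c x)
    (α β : ℝ)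
    (u : ℝ → ℝ → ℝ)
    (hu : ContDiff ℝ 2 (fun p : ℝ × ℝ => u p.1 p.2))
    (huwave : ∀ x ∈ Set.Icc (0:ℝ) L, ∀ t ∈ Set.Icc (0:ℝ) T,
      deriv (deriv (u x)) t = (c x) ^ 2 * deriv (deriv (fun z => u z t)) x)
    (hu0 : ∀ x ∈ Set.Icc (0:ℝ) L, u x 0 = 0)
    (hu0' : ∀ x ∈ Set.Icc (0:ℝ) L, deriv (u x) 0 = 0) :
    ∫ x in (0:ℝ)..L, (α + β * x) * u x T / (c x) ^ 2 =
      ∫ t in (0:ℝ)..T, (T - t) *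
        ((α + β * L) * deriv (fun z => u z t) L - α * deriv (fun z => u z t) 0 -
          β * (u L t - u 0 t)) := by
  have hut : ∀ x, ContDiff ℝ 2 (u x) := fun x =>
    hu.comp (contDiff_const.prodMk contDiff_id : ContDiff ℝ 2 fun t : ℝ => (x, t))
  have hux : ∀ t, ContDiff ℝ 2 (fun z => u z t) := fun t =>
    hu.comp (contDiff_id.prodMk contDiff_const : ContDiff ℝ 2 fun x : ℝ => (x, t))
  have huxx : Continuous (fun p : ℝ × ℝ => deriv (deriv (fun z => u z p.2)) p.1) :=
    ((hu.deriv_fst (n := 1) (by norm_num)).deriv_fst (n := 0) (by norm_num)).continuous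
  have hleft : ∀ x ∈ Set.uIcc 0 L, (α + β * x) * u x T / (c x) ^ 2 =
      ∫ t in (0:ℝ)..T, (α + β * x) * ((T - t) * deriv (deriv (fun z => u z t)) x) := by
    intro x hx
    rw [Set.uIcc_of_le hL.le] at hx
    have hcx := (hcpos x hx).ne'
    have h := integral_affine_mul_deriv_deriv (hut x) 0 T T (-1)
    have hw : ∫ t in (0:ℝ)..T, (T + -1 * t) * deriv (deriv (u x)) t =
        ∫ t in (0:ℝ)..T, (c x) ^ 2 * ((T - t) * deriv (deriv (fun z => u z t)) x) := by
      refine intervalIntegral.integral_congr fun t ht => ?_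
      rw [Set.uIcc_of_le hT.le] at ht
      simp only [huwave x hx t ht]
      ring
    rw [hw, intervalIntegral.integral_const_mul, hu0 x hx, hu0' x hx] at h
    rw [intervalIntegral.integral_const_mul, div_eq_iff (pow_ne_zero 2 hcx)]
    linear_combination -(α + β * x) * h
  have hint : IntegrableOn (Function.uncurry fun x t : ℝ =>
      (α + β * x) * ((T - t) * deriv (deriv (fun z => u z t)) x))
      (Set.uIoc 0 L ×ˢ Set.uIoc 0 T) := by
    refine IntegrableOn.mono_set (t := Set.uIcc 0 L ×ˢ Set.uIcc 0 T) ?_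
      (Set.prod_mono Set.uIoc_subset_uIcc Set.uIoc_subset_uIcc)
    refine Continuous.continuousOn ?_ |>.integrableOn_compact (isCompact_uIcc.prod isCompact_uIcc)
    exact (by fun_prop : Continuous fun p : ℝ × ℝ => α + β * p.1).mul
      ((by fun_prop : Continuous fun p : ℝ × ℝ => T - p.2).mul huxx)
  rw [intervalIntegral.integral_congr hleft,
    intervalIntegral_intervalIntegral_swap hint]
  refine intervalIntegral.integral_congr fun t _ => ?_
  have h := integral_affine_mul_deriv_deriv (hux t) 0 L α β
  calc ∫ x in (0:ℝ)..L, (α + β * x) * ((T - t) * deriv (deriv (fun z => u z t)) x)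
      = ∫ x in (0:ℝ)..L, (T - t) * ((α + β * x) * deriv (deriv (fun z => u z t)) x) := by
        congr 1 with x
        ring
    _ = _ := by
        rw [intervalIntegral.integral_const_mul, h]
        ring
end
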